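/- Lower bound L₁^{r,ε} of Theorem 2: Let (S,X,T) be jointly distributed random variables with values in finite sets, let ε satisfy 0 ≤ ε < min{I(S;X), H(S)}, and let r satisfy 0 ≤ r ≤ H(X|S) + ε. Then there exists a probability space carrying random variables (S',X',T',Y) such that (S',X',T') has the same joint distribution as (S,X,T), Y takes values in a finite set, I(Y;S') ≤ ε, I(X';Y) ≤ r, and I(Y;T') ≥ H(T|(X,S)) + r − H((X,S)|T). -/

import Mathlib

open MeasureTheory ProbabilityTheory

/-- Shannon entropy (base 2) of a random variable with values in a finite type,
with the convention `0 · log₂ 0 = 0`. -/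
noncomputable def ent {Ω α : Type*} [MeasurableSpace Ω] [Fintype α]
    (μ : Measure Ω) (X : Ω → α) : ℝ :=
  ∑ a : α, -((μ (X ⁻¹' {a})).toReal * Real.logb 2 ((μ (X ⁻¹' {a})).toReal))

/-- Conditional Shannon entropy `H(X | Y)` (base 2). -/
noncomputable def condEnt {Ω α β : Type*} [MeasurableSpace Ω] [Fintype α] [Fintype β]
    (μ : Measure Ω) (X : Ω → α) (Y : Ω → β) : ℝ :=
  ent μ (fun ω => (X ω, Y ω)) - ent μ Y

/-- Mutual information `I(X ; Y)` (base 2). -/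
noncomputable def mutInf {Ω α β : Type*} [MeasurableSpace Ω] [Fintype α] [Fintype β]
    (μ : Measure Ω) (X : Ω → α) (Y : Ω → β) : ℝ :=
  ent μ X + ent μ Y - ent μ (fun ω => (X ω, Y ω))

/-- Conditional mutual information `I(X ; Y | Z)` (base 2). -/
noncomputable def condMutInf {Ω α β γ : Type*} [MeasurableSpace Ω] [Fintype α] [Fintype β]
    [Fintype γ] (μ : Measure Ω) (X : Ω → α) (Y : Ω → β) (Z : Ω → γ) : ℝ :=
  ent μ (fun ω => (X ω, Z ω)) + ent μ (fun ω => (Y ω, Z ω))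
    - ent μ (fun ω => (X ω, Y ω, Z ω)) - ent μ Z

/-- Entropy is invariant under injective relabelling. -/
theorem ent_comp_inj {Ω α β : Type*} [MeasurableSpace Ω] [Fintype α] [Fintype β]
    (μ : Measure Ω) (X : Ω → α) (e : α → β) (he : Function.Injective e) :
    ent μ (fun ω => e (X ω)) = ent μ X := by
  classical
  unfold ent
  have h1 : ∀ a : α, (fun ω => e (X ω)) ⁻¹' {e a} = X ⁻¹' {a} := by
    intro a; ext ω; simp [he.eq_iff]
  symm
  rw [← Finset.sum_subset (Finset.subset_univ (Finset.univ.image e))]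
  · rw [Finset.sum_image (fun a _ b _ h => he h)]
    exact Finset.sum_congr rfl fun a _ => by rw [h1]
  · intro b _ hb
    have : (fun ω => e (X ω)) ⁻¹' {b} = ∅ := by
      ext ω
      simp only [Set.mem_preimage, Set.mem_singleton_iff, Set.mem_empty_iff_false, iff_false]
      intro h
      exact hb (by rw [← h]; simp)
    rw [this]; simp

theorem ent_comp_fst {Ω₁ Ω₂ α : Type*} [MeasurableSpace Ω₁] [MeasurableSpace Ω₂] [Fintype α]
    (μ : Measure Ω₁) (ν : Measure Ω₂) [IsProbabilityMeasure μ] [IsProbabilityMeasure ν]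
    (A : Ω₁ → α) : ent (μ.prod ν) (fun ω => A ω.1) = ent μ A := by
  unfold ent
  refine Finset.sum_congr rfl fun a _ => ?_
  have : (fun ω : Ω₁ × Ω₂ => A ω.1) ⁻¹' {a} = (A ⁻¹' {a}) ×ˢ Set.univ := by ext; simp
  rw [this, Measure.prod_prod]; simp

theorem ent_comp_snd {Ω₁ Ω₂ α : Type*} [MeasurableSpace Ω₁] [MeasurableSpace Ω₂] [Fintype α]
    (μ : Measure Ω₁) (ν : Measure Ω₂) [IsProbabilityMeasure μ] [IsProbabilityMeasure ν]
    (A : Ω₂ → α) : ent (μ.prod ν) (fun ω => A ω.2) = ent ν A := by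
  unfold ent
  refine Finset.sum_congr rfl fun a _ => ?_
  have : (fun ω : Ω₁ × Ω₂ => A ω.2) ⁻¹' {a} = Set.univ ×ˢ (A ⁻¹' {a}) := by ext; simp
  rw [this, Measure.prod_prod]; simp

theorem sum_prob {Ω α : Type*} [MeasurableSpace Ω] [DiscreteMeasurableSpace Ω] [Fintype α]
    (μ : Measure Ω) [IsProbabilityMeasure μ] (A : Ω → α) :
    ∑ a, (μ (A ⁻¹' {a})).toReal = 1 := by
  have h := sum_measureReal_preimage_singleton (μ := μ) (f := A) Finset.univ
    (fun y _ => MeasurableSet.of_discrete)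
  simpa [Measure.real] using h

theorem mul_logb_mul (x y : ℝ) :
    x * y * Real.logb 2 (x * y) = y * (x * Real.logb 2 x) + x * (y * Real.logb 2 y) := by
  by_cases hx : x = 0
  · simp [hx]
  by_cases hy : y = 0
  · simp [hy]
  rw [Real.logb_mul hx hy]; ring

/-- Mixture formula. -/
theorem ent_mix {Ω₁ C α : Type*} [MeasurableSpace Ω₁] [MeasurableSpace C] [Fintype C] [Fintype α]
    [DiscreteMeasurableSpace Ω₁]
    (μ : Measure Ω₁) (ν : Measure C) [IsProbabilityMeasure μ] [IsProbabilityMeasure ν]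
    (A : C → Ω₁ → α) :
    ent (μ.prod ν) (fun ω => (ω.2, A ω.2 ω.1))
      = ent ν (fun c => c) + ∑ c, (ν {c}).toReal * ent μ (A c) := by
  unfold ent
  rw [Fintype.sum_prod_type, ← Finset.sum_add_distrib]
  refine Finset.sum_congr rfl fun c _ => ?_
  have h : ∀ a, (fun ω : Ω₁ × C => (ω.2, A ω.2 ω.1)) ⁻¹' {(c, a)} = (A c ⁻¹' {a}) ×ˢ {c} := by
    intro a; ext ⟨x, d⟩
    simp only [Set.mem_preimage, Set.mem_singleton_iff, Prod.mk.injEq, Set.mem_prod]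
    constructor
    · rintro ⟨rfl, h⟩; exact ⟨h, rfl⟩
    · rintro ⟨h, rfl⟩; exact ⟨rfl, h⟩
  have h2 : (fun c : C => c) ⁻¹' {c} = {c} := rfl
  simp only [h, Measure.prod_prod, ENNReal.toReal_mul, mul_logb_mul, h2, neg_add,
    Finset.sum_add_distrib, Finset.mul_sum]
  rw [add_comm]
  congr 1
  · rw [Finset.sum_neg_distrib, ← Finset.sum_mul, sum_prob, one_mul]
  · refine Finset.sum_congr rfl fun a _ => by ring

theorem ent_prod {Ω₁ Ω₂ α β : Type*} [MeasurableSpace Ω₁] [MeasurableSpace Ω₂]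
    [Fintype α] [Fintype β] [DiscreteMeasurableSpace Ω₁] [DiscreteMeasurableSpace Ω₂]
    (μ : Measure Ω₁) (ν : Measure Ω₂) [IsProbabilityMeasure μ] [IsProbabilityMeasure ν]
    (A : Ω₁ → α) (B : Ω₂ → β) :
    ent (μ.prod ν) (fun ω => (A ω.1, B ω.2)) = ent μ A + ent ν B := by
  unfold ent
  rw [Fintype.sum_prod_type]
  have h : ∀ a b, (fun ω : Ω₁ × Ω₂ => (A ω.1, B ω.2)) ⁻¹' {(a, b)}
      = (A ⁻¹' {a}) ×ˢ (B ⁻¹' {b}) := by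
    intro a b; ext; simp
  simp only [h, Measure.prod_prod, ENNReal.toReal_mul, mul_logb_mul, neg_add,
    Finset.sum_add_distrib]
  congr 1
  · refine Finset.sum_congr rfl fun a _ => ?_
    rw [Finset.sum_neg_distrib, ← Finset.sum_mul, sum_prob, one_mul]
  · rw [Finset.sum_comm]
    refine Finset.sum_congr rfl fun a _ => ?_
    rw [Finset.sum_neg_distrib, ← Finset.sum_mul, sum_prob, one_mul]

theorem prob_marg {Ω α β : Type*} [MeasurableSpace Ω] [DiscreteMeasurableSpace Ω]
    [Fintype α] (μ : Measure Ω) [IsProbabilityMeasure μ] (A : Ω → α) (B : Ω → β) (b : β) :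
    (μ (B ⁻¹' {b})).toReal = ∑ a, (μ ((fun ω => (A ω, B ω)) ⁻¹' {(a, b)})).toReal := by
  have h := sum_measureReal_preimage_singleton (μ := μ.restrict (B ⁻¹' {b})) (f := A) Finset.univ
    (fun y _ => MeasurableSet.of_discrete)
  have h2 : ∀ a, (fun ω => (A ω, B ω)) ⁻¹' {(a, b)} = A ⁻¹' {a} ∩ B ⁻¹' {b} := by
    intro a; ext; simp
  simp only [Measure.real, Measure.restrict_apply MeasurableSet.of_discrete] at h
  simp only [h2, h]; simp

theorem submod_pt (q qa qb qz : ℝ) (hq : 0 ≤ q) (ha : q ≤ qa) (hb : q ≤ qb) (hz : q ≤ qz) :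
    q - qa * qb / qz ≤ q * (Real.log q + Real.log qz - Real.log qa - Real.log qb) := by
  rcases hq.eq_or_lt with h | h
  · have : 0 ≤ qa * qb / qz :=
      div_nonneg (mul_nonneg (hq.trans ha) (hq.trans hb)) (hq.trans hz)
    rw [← h]; simp; exact this
  · have h1 : 0 < qa := by linarith
    have h2 : 0 < qb := by linarith
    have h3 : 0 < qz := by linarith
    have := Real.log_le_sub_one_of_pos (x := qa * qb / (q * qz)) (by positivity)
    rw [Real.log_div (by positivity) (by positivity), Real.log_mul h1.ne' h2.ne',
      Real.log_mul h.ne' h3.ne'] at this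
    have h4 := mul_le_mul_of_nonneg_left this h.le
    have h5 : q * (qa * qb / (q * qz) - 1) = qa * qb / qz - q := by field_simp
    rw [h5] at h4
    linarith

/-- Submodularity of entropy. -/
theorem ent_submod {Ω α β γ : Type*} [MeasurableSpace Ω] [DiscreteMeasurableSpace Ω]
    [Fintype α] [Fintype β] [Fintype γ] (μ : Measure Ω) [IsProbabilityMeasure μ]
    (A : Ω → α) (B : Ω → β) (Z : Ω → γ) :
    ent μ Z + ent μ (fun ω => (A ω, B ω, Z ω))
      ≤ ent μ (fun ω => (A ω, Z ω)) + ent μ (fun ω => (B ω, Z ω)) := by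
  set q : α → β → γ → ℝ := fun a b z => (μ ((fun ω => (A ω, B ω, Z ω)) ⁻¹' {(a, b, z)})).toReal
    with hq
  set qa : α → γ → ℝ := fun a z => (μ ((fun ω => (A ω, Z ω)) ⁻¹' {(a, z)})).toReal with hqa
  set qb : β → γ → ℝ := fun b z => (μ ((fun ω => (B ω, Z ω)) ⁻¹' {(b, z)})).toReal with hqb
  set qz : γ → ℝ := fun z => (μ (Z ⁻¹' {z})).toReal with hqz
  have q0 : ∀ a b z, 0 ≤ q a b z := fun a b z => ENNReal.toReal_nonneg
  have mono : ∀ {s t : Set Ω}, s ⊆ t → (μ s).toReal ≤ (μ t).toReal := fun h =>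
    ENNReal.toReal_mono (measure_ne_top _ _) (measure_mono h)
  have e1 : ∀ z, qz z = ∑ a, qa a z := fun z => prob_marg μ A Z z
  have e2 : ∀ z, qz z = ∑ b, qb b z := fun z => prob_marg μ B Z z
  have e3 : ∀ b z, qb b z = ∑ a, q a b z := fun b z => prob_marg μ A (fun ω => (B ω, Z ω)) (b, z)
  have e4 : ∀ a z, qa a z = ∑ b, q a b z := by
    intro a z
    rw [hqa]; simp only
    rw [prob_marg μ B (fun ω => (A ω, Z ω)) (a, z)]
    refine Finset.sum_congr rfl fun b _ => ?_
    simp only [hq]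
    congr 2
    ext; simp; tauto
  have key : ∀ z, ∑ a, ∑ b, (q a b z - qa a z * qb b z / qz z)
      ≤ ∑ a, ∑ b, q a b z * (Real.log (q a b z) + Real.log (qz z) - Real.log (qa a z)
        - Real.log (qb b z)) := by
    intro z
    refine Finset.sum_le_sum fun a _ => Finset.sum_le_sum fun b _ => ?_
    refine submod_pt _ _ _ _ (q0 a b z) (mono ?_) (mono ?_) (mono ?_)
    · intro ω; simp +contextual
    · intro ω; simp +contextual
    · intro ω; simp
  have lhs0 : ∀ z, ∑ a, ∑ b, (q a b z - qa a z * qb b z / qz z) = 0 := by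
    intro z
    simp only [Finset.sum_sub_distrib, ← e4, ← e1]
    simp only [mul_div_assoc, ← Finset.mul_sum, ← Finset.sum_div, ← e2, ← Finset.sum_mul, ← e1]
    by_cases h : qz z = 0
    · simp [h]
    · field_simp; simp
  have tot : 0 ≤ ∑ z, ∑ a, ∑ b, q a b z * (Real.log (q a b z) + Real.log (qz z)
      - Real.log (qa a z) - Real.log (qb b z)) :=
    Finset.sum_nonneg fun z _ => (lhs0 z).symm.le.trans (key z)
  have expand : ∀ z, ∑ a, ∑ b, q a b z * (Real.log (q a b z) + Real.log (qz z)
      - Real.log (qa a z) - Real.log (qb b z))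
      = (∑ a, ∑ b, q a b z * Real.log (q a b z)) + qz z * Real.log (qz z)
        - (∑ a, qa a z * Real.log (qa a z)) - ∑ b, qb b z * Real.log (qb b z) := by
    intro z
    simp only [mul_sub, mul_add, Finset.sum_sub_distrib, Finset.sum_add_distrib]
    congr 1
    · congr 1
      · congr 1
        simp only [← Finset.sum_mul, ← e4, ← e1]
      · simp only [← Finset.sum_mul, ← e4]
    · rw [Finset.sum_comm]
      simp only [← Finset.sum_mul, ← e3]
  simp only [expand, Finset.sum_sub_distrib, Finset.sum_add_distrib] at tot
  have d1 : ent μ Z = -(∑ z, qz z * Real.log (qz z)) / Real.log 2 := by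
    simp only [ent, Real.logb, Finset.sum_neg_distrib, neg_div, Finset.sum_div, mul_div_assoc, hqz]
  have d2 : ent μ (fun ω => (A ω, Z ω))
      = -(∑ z, ∑ a, qa a z * Real.log (qa a z)) / Real.log 2 := by
    simp only [ent, Real.logb, Finset.sum_neg_distrib, neg_div, Finset.sum_div, mul_div_assoc, hqa,
      Fintype.sum_prod_type]
    rw [Finset.sum_comm]
  have d3 : ent μ (fun ω => (B ω, Z ω))
      = -(∑ z, ∑ a, qb a z * Real.log (qb a z)) / Real.log 2 := by
    simp only [ent, Real.logb, Finset.sum_neg_distrib, neg_div, Finset.sum_div, mul_div_assoc, hqb,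
      Fintype.sum_prod_type]
    rw [Finset.sum_comm]
  have d4 : ent μ (fun ω => (A ω, B ω, Z ω))
      = -(∑ z, ∑ a, ∑ b, q a b z * Real.log (q a b z)) / Real.log 2 := by
    simp only [ent, Real.logb, Finset.sum_neg_distrib, neg_div, Finset.sum_div, mul_div_assoc, hq,
      Fintype.sum_prod_type]
    congr 1
    symm
    rw [Finset.sum_comm]
    exact Finset.sum_congr rfl fun a _ => Finset.sum_comm
  rw [d1, d2, d3, d4, ← add_div, ← add_div]
  have hl : 0 < Real.log 2 := Real.log_pos (by norm_num)
  refine div_le_div_of_nonneg_right ?_ hl.le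
  linarith

theorem ent_mono {Ω α γ : Type*} [MeasurableSpace Ω] [DiscreteMeasurableSpace Ω]
    [Fintype α] [Fintype γ] (μ : Measure Ω) [IsProbabilityMeasure μ]
    (A : Ω → α) (Z : Ω → γ) : ent μ Z ≤ ent μ (fun ω => (A ω, Z ω)) := by
  have h := ent_submod μ A A Z
  have h2 := ent_comp_inj μ (fun ω => (A ω, Z ω)) (fun p : α × γ => (p.1, p.1, p.2))
    (by rintro ⟨a, b⟩ ⟨c, d⟩ h; simp at h; simp [h])
  simp only at h2
  linarith

/-- Mixture formula for mutual information. -/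
theorem mutInf_mix {Ω₁ C α β : Type*} [MeasurableSpace Ω₁] [MeasurableSpace C] [Fintype C]
    [Fintype α] [Fintype β] [DiscreteMeasurableSpace Ω₁] [DiscreteMeasurableSpace C]
    (μ : Measure Ω₁) (ν : Measure C) [IsProbabilityMeasure μ] [IsProbabilityMeasure ν]
    (A : C → Ω₁ → α) (B : Ω₁ → β) :
    mutInf (μ.prod ν) (fun ω => (ω.2, A ω.2 ω.1)) (fun ω => B ω.1)
      = ∑ c, (ν {c}).toReal * mutInf μ (A c) B := by
  unfold mutInf
  rw [ent_mix, ent_comp_fst]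
  have h1 := ent_mix μ ν (fun c ω => (A c ω, B ω))
  have h2 := ent_comp_inj (μ.prod ν) (fun ω => (ω.2, A ω.2 ω.1, B ω.1))
    (fun p : C × α × β => ((p.1, p.2.1), p.2.2))
    (by rintro ⟨a, b, c⟩ ⟨d, e, f⟩ h; simp at h; simp [h])
  simp only at h2
  rw [h2, h1]
  have h3 := sum_prob ν (fun c => c)
  have h4 : ∀ c : C, (fun c : C => c) ⁻¹' {c} = {c} := fun c => rfl
  simp only [h4] at h3
  simp only [mul_sub, mul_add, Finset.sum_sub_distrib, Finset.sum_add_distrib, ← Finset.sum_mul, h3]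
  ring

theorem ent_congr_ident {Ω Ω' δ α : Type*} [MeasurableSpace Ω] [MeasurableSpace Ω']
    [MeasurableSpace δ] [DiscreteMeasurableSpace δ] [Fintype α]
    {μ : Measure Ω} {μ' : Measure Ω'} {Z : Ω → δ} {Z' : Ω' → δ}
    (h : IdentDistrib Z Z' μ μ') (k : δ → α) :
    ent μ (fun ω => k (Z ω)) = ent μ' (fun ω => k (Z' ω)) := by
  unfold ent
  refine Finset.sum_congr rfl fun a _ => ?_
  have := h.measure_mem_eq (s := k ⁻¹' {a}) MeasurableSet.of_discrete
  have e1 : (fun ω => k (Z ω)) ⁻¹' {a} = Z ⁻¹' (k ⁻¹' {a}) := rfl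
  have e2 : (fun ω => k (Z' ω)) ⁻¹' {a} = Z' ⁻¹' (k ⁻¹' {a}) := rfl
  rw [e1, e2, this]

/-- The coin. -/
theorem exists_coin (p : Fin 3 → ℝ) (h0 : ∀ c, 0 ≤ p c) (h1 : ∑ c, p c = 1) :
    ∃ ν : Measure (Fin 3), IsProbabilityMeasure ν ∧ ∀ c, (ν {c}).toReal = p c := by
  refine ⟨∑ c, ENNReal.ofReal (p c) • Measure.dirac c, ⟨?_⟩, ?_⟩
  · simp only [Measure.finsetSum_apply, Measure.smul_apply, measure_univ, smul_eq_mul, mul_one]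
    rw [← ENNReal.ofReal_sum_of_nonneg (fun c _ => h0 c), h1]; simp
  · intro c
    rw [Measure.finsetSum_apply, Finset.sum_eq_single c]
    · simp [h0]
    · intro b _ hb
      simp [hb]
    · simp

/-- The functional representation: `X = f S`, `T = g (X, S)` with `g, f, S` independent. -/
theorem exists_frl
    {Ω 𝒮 𝒳 𝒯 : Type} [MeasurableSpace Ω] (μ : Measure Ω) [IsProbabilityMeasure μ]
    [Fintype 𝒮] [MeasurableSpace 𝒮] [MeasurableSingletonClass 𝒮]
    [Fintype 𝒳] [MeasurableSpace 𝒳] [MeasurableSingletonClass 𝒳]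
    [Fintype 𝒯] [MeasurableSpace 𝒯] [MeasurableSingletonClass 𝒯]
    (S : Ω → 𝒮) (X : Ω → 𝒳) (T : Ω → 𝒯)
    (hS : Measurable S) (hX : Measurable X) (hT : Measurable T) :
    ∃ (μG : Measure (𝒳 × 𝒮 → 𝒯)) (μF : Measure (𝒮 → 𝒳)) (μS : Measure 𝒮),
      IsProbabilityMeasure μG ∧ IsProbabilityMeasure μF ∧ IsProbabilityMeasure μS ∧
      ∀ s x t, μ ((fun ω => (S ω, X ω, T ω)) ⁻¹' {(s, x, t)})
        = μG {g | g (x, s) = t} * (μF {f | f s = x} * μS {s}) := by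
  classical
  have hΩ : Nonempty Ω := nonempty_of_isProbabilityMeasure μ
  have : Nonempty 𝒳 := hΩ.map X
  have : Nonempty 𝒯 := hΩ.map T
  have hXS : Measurable (fun ω => (X ω, S ω)) := hX.prodMk hS
  refine ⟨Measure.pi fun w => condDistrib T (fun ω => (X ω, S ω)) μ w,
    Measure.pi fun s => condDistrib X S μ s, μ.map S, inferInstance, inferInstance,
    Measure.isProbabilityMeasure_map hS.aemeasurable, ?_⟩
  intro s x t
  have eg : (Measure.pi fun w => condDistrib T (fun ω => (X ω, S ω)) μ w) {g | g (x, s) = t}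
      = condDistrib T (fun ω => (X ω, S ω)) μ (x, s) {t} :=
    (measurePreserving_eval (fun w => condDistrib T (fun ω => (X ω, S ω)) μ w)
      (x, s)).measure_preimage (measurableSet_singleton t).nullMeasurableSet
  have ef : (Measure.pi fun s => condDistrib X S μ s) {f | f s = x}
      = condDistrib X S μ s {x} :=
    (measurePreserving_eval (fun s => condDistrib X S μ s)
      s).measure_preimage (measurableSet_singleton x).nullMeasurableSet
  rw [eg, ef]
  have a1 : condDistrib X S μ s {x} * μ.map S {s} = μ.map (fun ω => (X ω, S ω)) {(x, s)} := by
    rw [Measure.map_apply hXS (measurableSet_singleton _)]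
    by_cases h : μ.map S {s} = 0
    · rw [h, mul_zero]
      rw [Measure.map_apply hS (measurableSet_singleton _)] at h
      exact (measure_mono_null (by intro ω; simp) h).symm
    · rw [condDistrib_apply_of_ne_zero hX s h, mul_comm, ← mul_assoc,
        ENNReal.mul_inv_cancel h (by
          rw [Measure.map_apply hS (measurableSet_singleton _)]; exact measure_ne_top _ _), one_mul,
        Measure.map_apply (hS.prodMk hX) (by measurability)]
      congr 1; ext; simp; tauto
  rw [a1]
  by_cases h : μ.map (fun ω => (X ω, S ω)) {(x, s)} = 0
  · rw [h, mul_zero]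
    rw [Measure.map_apply hXS (measurableSet_singleton _)] at h
    exact measure_mono_null (by intro ω; simp; tauto) h
  · rw [condDistrib_apply_of_ne_zero hT (x, s) h, mul_comm, ← mul_assoc,
      ENNReal.mul_inv_cancel h (by
        rw [Measure.map_apply hXS (measurableSet_singleton _)]; exact measure_ne_top _ _), one_mul,
      Measure.map_apply (hXS.prodMk hT) (by measurability)]
    congr 1; ext; simp; tauto

/-- **Lower bound `L₁^{r,ε}` of Theorem 2.** For `0 ≤ ε < min{I(S;X), H(S)}` and `0 ≤ r ≤ H(X|S) + ε` there is a representation `Y` with `I(Y;S') ≤ ε`, `I(X';Y) ≤ r`, and `I(Y;T') ≥ H(T|(X,S)) + r − H((X,S)|T)`. -/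
theorem lower_bound_L1re
    {Ω 𝒮 𝒳 𝒯 : Type} [MeasurableSpace Ω] (μ : Measure Ω) [IsProbabilityMeasure μ]
    [Fintype 𝒮] [MeasurableSpace 𝒮] [MeasurableSingletonClass 𝒮]
    [Fintype 𝒳] [MeasurableSpace 𝒳] [MeasurableSingletonClass 𝒳]
    [Fintype 𝒯] [MeasurableSpace 𝒯] [MeasurableSingletonClass 𝒯]
    (S : Ω → 𝒮) (X : Ω → 𝒳) (T : Ω → 𝒯)
    (hS : Measurable S) (hX : Measurable X) (hT : Measurable T)
    (ε : ℝ) (hε0 : 0 ≤ ε) (hε1 : ε < min (mutInf μ S X) (ent μ S))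
    (r : ℝ) (hr0 : 0 ≤ r) (hr1 : r ≤ condEnt μ X S + ε) :
    ∃ (Ω' : Type) (_ : MeasurableSpace Ω') (μ' : Measure Ω')
      (𝒴 : Type) (_ : Fintype 𝒴) (_ : MeasurableSpace 𝒴)
      (S' : Ω' → 𝒮) (X' : Ω' → 𝒳) (T' : Ω' → 𝒯) (Y : Ω' → 𝒴),
      IsProbabilityMeasure μ' ∧
      Measurable S' ∧ Measurable X' ∧ Measurable T' ∧ Measurable Y ∧
      IdentDistrib (fun ω => (S ω, X ω, T ω)) (fun ω => (S' ω, X' ω, T' ω)) μ μ' ∧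
      mutInf μ' Y S' ≤ ε ∧ mutInf μ' X' Y ≤ r ∧
      mutInf μ' Y T' ≥ condEnt μ T (fun ω => (X ω, S ω)) + r - condEnt μ (fun ω => (X ω, S ω)) T := by
  classical
  obtain ⟨μG, μF, μS, iG, iF, iS, hlaw⟩ := exists_frl μ S X T hS hX hT
  set hs := ent μ S with hs_def
  set c0 := condEnt μ X S with c0_def
  have hεS : ε < hs := lt_of_lt_of_le hε1 (min_le_right _ _)
  have hs_pos : 0 < hs := lt_of_le_of_lt hε0 hεS
  have hr0' : 0 ≤ c0 + ε := hr0.trans hr1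
  obtain ⟨β, hβ0, hβ1, hβ⟩ : ∃ β : ℝ, 0 ≤ β ∧ β ≤ 1 ∧ β * (c0 + ε) = r := by
    rcases hr0'.eq_or_lt with h | h
    · exact ⟨0, le_rfl, zero_le_one, by linarith⟩
    · exact ⟨r / (c0 + ε), by positivity, (div_le_one h).2 hr1, by field_simp⟩
  obtain ⟨α, hα0, hα1, hα⟩ : ∃ α : ℝ, 0 ≤ α ∧ α ≤ 1 ∧ α * hs = ε :=
    ⟨ε / hs, by positivity, (div_le_one hs_pos).2 hεS.le, by field_simp⟩
  obtain ⟨ν, iν, hν⟩ := exists_coin ![1 - β, β * (1 - α), β * α]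
    (by
      intro c
      fin_cases c
      · simpa using hβ1
      · exact mul_nonneg hβ0 (by linarith)
      · exact mul_nonneg hβ0 hα0)
    (by simp [Fin.sum_univ_three]; ring)
  let Z := (𝒳 × 𝒮 → 𝒯) × ((𝒮 → 𝒳) × 𝒮)
  let μZ : Measure Z := μG.prod (μF.prod μS)
  let s' : Z → 𝒮 := fun z => z.2.2
  let x' : Z → 𝒳 := fun z => z.2.1 z.2.2
  let t' : Z → 𝒯 := fun z => z.1 (z.2.1 z.2.2, z.2.2)
  let A : Fin 3 → Z → (𝒳 × 𝒮 → 𝒯) × Option ((𝒮 → 𝒳) × Option 𝒮) :=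
    ![fun z => (z.1, none), fun z => (z.1, some (z.2.1, none)),
      fun z => (z.1, some (z.2.1, some z.2.2))]
  let μ' : Measure (Z × Fin 3) := μZ.prod ν
  let Y : Z × Fin 3 → Fin 3 × ((𝒳 × 𝒮 → 𝒯) × Option ((𝒮 → 𝒳) × Option 𝒮)) :=
    fun ω => (ω.2, A ω.2 ω.1)
  have hid : IdentDistrib (fun ω => (S ω, X ω, T ω))
      (fun ω : Z × Fin 3 => (s' ω.1, x' ω.1, t' ω.1)) μ μ' := by
    refine ⟨(hS.prodMk (hX.prodMk hT)).aemeasurable, Measurable.of_discrete.aemeasurable, ?_⟩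
    refine Measure.ext_of_singleton fun a => ?_
    obtain ⟨s, x, t⟩ := a
    rw [Measure.map_apply (hS.prodMk (hX.prodMk hT)) (measurableSet_singleton _),
      Measure.map_apply Measurable.of_discrete (measurableSet_singleton _), hlaw]
    have : (fun ω : Z × Fin 3 => (s' ω.1, x' ω.1, t' ω.1)) ⁻¹' {(s, x, t)}
        = ({g : 𝒳 × 𝒮 → 𝒯 | g (x, s) = t} ×ˢ ({f : 𝒮 → 𝒳 | f s = x} ×ˢ ({s} : Set 𝒮)))
          ×ˢ (Set.univ : Set (Fin 3)) := by
      ext ⟨⟨g, f, u⟩, c⟩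
      simp only [Set.mem_preimage, Set.mem_singleton_iff, Prod.mk.injEq, Set.mem_prod,
        Set.mem_ofPred_eq, Set.mem_univ, and_true, s', x', t']
      constructor
      · rintro ⟨rfl, rfl, rfl⟩; exact ⟨rfl, rfl, rfl⟩
      · rintro ⟨rfl, rfl, rfl⟩; exact ⟨rfl, rfl, rfl⟩
    rw [this, Measure.prod_prod, Measure.prod_prod, Measure.prod_prod]
    simp
  -- transfer of entropies
  have trZ : ∀ {δ : Type} [Fintype δ] (k : 𝒮 × 𝒳 × 𝒯 → δ),
      ent μ (fun ω => k (S ω, X ω, T ω)) = ent μ' (fun ω => k (s' ω.1, x' ω.1, t' ω.1)) :=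
    fun k => ent_congr_ident hid k
  have eS : hs = ent μZ s' := by
    rw [hs_def, trZ (fun p => p.1)]; exact ent_comp_fst μZ ν s'
  have eW : ent μ (fun ω => (X ω, S ω)) = ent μZ (fun z => (x' z, s' z)) := by
    rw [trZ (fun p => (p.2.1, p.1))]; exact ent_comp_fst μZ ν (fun z => (x' z, s' z))
  have eS2 : ent μZ s' = ent μS (fun s => s) := by
    have h1 := ent_comp_snd μG (μF.prod μS) (fun z => z.2)
    have h2 := ent_comp_snd μF μS (fun s => s)
    exact h1.trans h2
  -- entropies of the pieces
  have eGF : ent μZ (fun z => (z.1, z.2.1)) = ent μG (fun g => g) + ent μF (fun f => f) := by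
    have h1 := ent_prod μG (μF.prod μS) (fun g => g) (fun z => z.1)
    have h2 := ent_comp_fst μF μS (fun f => f)
    rw [← h2]; exact h1
  have eGFS : ent μZ (fun z => (z.1, z.2.1, z.2.2))
      = ent μG (fun g => g) + (ent μF (fun f => f) + ent μZ s') := by
    have h1 := ent_prod μG (μF.prod μS) (fun g => g) (fun z => (z.1, z.2))
    have h2 := ent_prod μF μS (fun f => f) (fun s => s)
    rw [eS2, ← h2]; exact h1
  have eG : ent μZ (fun z => z.1) = ent μG (fun g => g) := ent_comp_fst μG (μF.prod μS) (fun g => g)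
  have eGS : ent μZ (fun z => (z.1, s' z)) = ent μG (fun g => g) + ent μZ s' := by
    have h1 := ent_prod μG (μF.prod μS) (fun g => g) (fun z => z.2)
    have h2 := ent_comp_snd μG (μF.prod μS) (fun z => z.2)
    change _ = _ + ent (μG.prod (μF.prod μS)) (fun z => z.2.2)
    rw [h2]; exact h1
  have eGW : ent μZ (fun z => (z.1, (x' z, s' z)))
      = ent μG (fun g => g) + ent μZ (fun z => (x' z, s' z)) := by
    have h1 := ent_prod μG (μF.prod μS) (fun g => g) (fun z => (z.1 z.2, z.2))
    have h2 := ent_comp_snd μG (μF.prod μS) (fun z => (z.1 z.2, z.2))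
    change _ = _ + ent (μG.prod (μF.prod μS)) (fun z => (z.2.1 z.2.2, z.2.2))
    rw [h2]; exact h1
  -- entropies of the `A c`
  have a0 : ent μZ (A 0) = ent μG (fun g => g) := by
    rw [← eG]
    exact ent_comp_inj μZ (fun z => z.1)
      (fun g => ((g, none) : (𝒳 × 𝒮 → 𝒯) × Option ((𝒮 → 𝒳) × Option 𝒮)))
      (by intro g g' h; simpa using h)
  have a1 : ent μZ (A 1) = ent μG (fun g => g) + ent μF (fun f => f) := by
    rw [← eGF]
    exact ent_comp_inj μZ (fun z => (z.1, z.2.1))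
      (fun p => ((p.1, some (p.2, none)) : (𝒳 × 𝒮 → 𝒯) × Option ((𝒮 → 𝒳) × Option 𝒮)))
      (by rintro ⟨a, b⟩ ⟨c, d⟩ h; simpa using h)
  have a2 : ent μZ (A 2) = ent μG (fun g => g) + (ent μF (fun f => f) + ent μZ s') := by
    rw [← eGFS]
    exact ent_comp_inj μZ (fun z => (z.1, z.2.1, z.2.2))
      (fun p => ((p.1, some (p.2.1, some p.2.2)) : (𝒳 × 𝒮 → 𝒯) × Option ((𝒮 → 𝒳) × Option 𝒮)))
      (by rintro ⟨a, b, e⟩ ⟨c, d, f⟩ h; simpa using h)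
  have s0 : ent μZ (fun z => (A 0 z, s' z)) = ent μG (fun g => g) + ent μZ s' := by
    rw [← eGS]
    exact ent_comp_inj μZ (fun z => (z.1, s' z))
      (fun p => (((p.1, none), p.2) : ((𝒳 × 𝒮 → 𝒯) × Option ((𝒮 → 𝒳) × Option 𝒮)) × 𝒮))
      (by rintro ⟨a, b⟩ ⟨c, d⟩ h; simpa using h)
  have s1 : ent μZ (fun z => (A 1 z, s' z))
      = ent μG (fun g => g) + (ent μF (fun f => f) + ent μZ s') := by
    rw [← eGFS]
    exact ent_comp_inj μZ (fun z => (z.1, z.2.1, z.2.2))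
      (fun p => (((p.1, some (p.2.1, none)), p.2.2) :
        ((𝒳 × 𝒮 → 𝒯) × Option ((𝒮 → 𝒳) × Option 𝒮)) × 𝒮))
      (by rintro ⟨a, b, e⟩ ⟨c, d, f⟩ h; simp at h; simp [h])
  have s2 : ent μZ (fun z => (A 2 z, s' z))
      = ent μG (fun g => g) + (ent μF (fun f => f) + ent μZ s') := by
    rw [← eGFS]
    exact ent_comp_inj μZ (fun z => (z.1, z.2.1, z.2.2))
      (fun p => (((p.1, some (p.2.1, some p.2.2)), p.2.2) :
        ((𝒳 × 𝒮 → 𝒯) × Option ((𝒮 → 𝒳) × Option 𝒮)) × 𝒮))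
      (by rintro ⟨a, b, e⟩ ⟨c, d, f⟩ h; simp at h; simp [h])
  have w0 : ent μZ (fun z => (A 0 z, (x' z, s' z)))
      = ent μG (fun g => g) + ent μZ (fun z => (x' z, s' z)) := by
    rw [← eGW]
    exact ent_comp_inj μZ (fun z => (z.1, (x' z, s' z)))
      (fun p => (((p.1, none), p.2) : ((𝒳 × 𝒮 → 𝒯) × Option ((𝒮 → 𝒳) × Option 𝒮)) × (𝒳 × 𝒮)))
      (by rintro ⟨a, b⟩ ⟨c, d⟩ h; simpa using h)
  have w1 : ent μZ (fun z => (A 1 z, (x' z, s' z)))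
      = ent μG (fun g => g) + (ent μF (fun f => f) + ent μZ s') := by
    rw [← eGFS]
    exact ent_comp_inj μZ (fun z => (z.1, z.2.1, z.2.2))
      (fun p => (((p.1, some (p.2.1, none)), (p.2.1 p.2.2, p.2.2)) :
        ((𝒳 × 𝒮 → 𝒯) × Option ((𝒮 → 𝒳) × Option 𝒮)) × (𝒳 × 𝒮)))
      (by rintro ⟨a, b, e⟩ ⟨c, d, f⟩ h; simp at h; simp [h])
  have w2 : ent μZ (fun z => (A 2 z, (x' z, s' z)))
      = ent μG (fun g => g) + (ent μF (fun f => f) + ent μZ s') := by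
    rw [← eGFS]
    exact ent_comp_inj μZ (fun z => (z.1, z.2.1, z.2.2))
      (fun p => (((p.1, some (p.2.1, some p.2.2)), (p.2.1 p.2.2, p.2.2)) :
        ((𝒳 × 𝒮 → 𝒯) × Option ((𝒮 → 𝒳) × Option 𝒮)) × (𝒳 × 𝒮)))
      (by rintro ⟨a, b, e⟩ ⟨c, d, f⟩ h; simp at h; simp [h])
  have mS : mutInf μ' Y (fun ω => s' ω.1) = β * ε := by
    have h := mutInf_mix μZ ν A s'
    refine h.trans ?_
    simp only [Fin.sum_univ_three, hν, mutInf, a0, a1, a2, s0, s1, s2, ← eS]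
    simp only [Matrix.cons_val]
    rw [← hα]; ring
  have hc0 : c0 = ent μZ (fun z => (x' z, s' z)) - hs := by
    rw [c0_def, condEnt, eW]
  have mW : mutInf μ' Y (fun ω => (x' ω.1, s' ω.1)) = r := by
    have h := mutInf_mix μZ ν A (fun z => (x' z, s' z))
    refine h.trans ?_
    simp only [Fin.sum_univ_three, hν, mutInf, a0, a1, a2, w0, w1, w2, ← eS]
    simp only [Matrix.cons_val]
    rw [← hβ, hc0, ← hα]; ring
  refine ⟨Z × Fin 3, inferInstance, μ', _, inferInstance, ⊤, fun ω => s' ω.1, fun ω => x' ω.1,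
    fun ω => t' ω.1, Y, inferInstance, Measurable.of_discrete, Measurable.of_discrete,
    Measurable.of_discrete, @Measurable.of_discrete _ _ _ ⊤ _ _, hid, ?_, ?_, ?_⟩
  · rw [mS]; nlinarith
  · rw [← mW]
    have h := ent_submod μ' (fun ω => s' ω.1) Y (fun ω => x' ω.1)
    have h2 := ent_comp_inj μ' (fun ω => (s' ω.1, Y ω, x' ω.1)) (fun p => (p.2.1, (p.2.2, p.1)))
      (by rintro ⟨a, b, e⟩ ⟨c, d, f⟩ h; simp only [Prod.mk.injEq] at h ⊢; tauto)
    have h3 := ent_comp_inj μ' (fun ω => (s' ω.1, x' ω.1)) Prod.swap Prod.swap_injective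
    have h4 := ent_comp_inj μ' (fun ω => (Y ω, x' ω.1)) Prod.swap Prod.swap_injective
    simp only [Prod.swap_prod_mk] at h2 h3 h4
    simp only [mutInf]
    linarith
  · have h1 := ent_mono μ' (fun ω => (x' ω.1, s' ω.1)) (fun ω => (Y ω, t' ω.1))
    have hA : ∀ c z, (A c z).1 = z.1 := by
      intro c z
      fin_cases c <;> rfl
    have h2 := ent_comp_inj μ' (fun ω => (Y ω, (x' ω.1, s' ω.1)))
      (fun p => (p.2, (p.1, p.1.2.1 p.2)))
      (by rintro ⟨a, b⟩ ⟨c, d⟩ h; simp only [Prod.mk.injEq] at h ⊢; tauto)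
    have h3 : (fun ω => ((x' ω.1, s' ω.1), (Y ω, (Y ω).2.1 (x' ω.1, s' ω.1))))
        = fun ω => ((x' ω.1, s' ω.1), (Y ω, t' ω.1)) := by
      funext ω
      simp only [Y, hA]
      rfl
    simp only at h2
    rw [h3] at h2
    have hT' : ent μ T = ent μ' (fun ω => t' ω.1) := trZ (fun p => p.2.2)
    have hW' : ent μ (fun ω => (X ω, S ω)) = ent μ' (fun ω => (x' ω.1, s' ω.1)) :=
      trZ (fun p => (p.2.1, p.1))
    have h5 := ent_comp_inj μ (fun ω => ((X ω, S ω), T ω)) Prod.swap Prod.swap_injective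
    simp only [Prod.swap_prod_mk] at h5
    simp only [mutInf] at mW
    simp only [mutInf, condEnt]
    rw [h5, hT', hW', ← mW]
    linarith
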